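/- In the braid group B_3, for every integer n: m(Δ^{−2n}σ1σ2) is conjugate to Δ^{2n−2}(σ1σ2)^2, and m(Δ^{−2n}(σ1σ2)^2) is conjugate to Δ^{2n−2}σ1σ2. -/

import Mathlib

/-- The defining relation of the braid group `B₃`: `σ₁σ₂σ₁ = σ₂σ₁σ₂`. -/
def braidRels : Set (FreeGroup (Fin 2)) :=
  {FreeGroup.of 0 * FreeGroup.of 1 * FreeGroup.of 0 *
    (FreeGroup.of 1 * FreeGroup.of 0 * FreeGroup.of 1)⁻¹}

/-- The braid group on three strands, presented by generators `σ₁, σ₂` with the single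
relation `σ₁σ₂σ₁ = σ₂σ₁σ₂`. -/
abbrev B₃ : Type := PresentedGroup braidRels

/-- The braid generator `σ₁`. -/
def σ₁ : B₃ := PresentedGroup.of 0

/-- The braid generator `σ₂`. -/
def σ₂ : B₃ := PresentedGroup.of 1

/-- The half twist `Δ = σ₁σ₂σ₁`. -/
def Δ : B₃ := σ₁ * σ₂ * σ₁

theorem braid_rel : σ₁ * σ₂ * σ₁ = σ₂ * σ₁ * σ₂ := by
  have h := PresentedGroup.one_of_mem (rels := braidRels) (Set.mem_singleton _)
  simp only [map_mul, map_inv] at h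
  exact mul_inv_eq_one.mp h

/-- In `B₃`, for the mirror homomorphism `m` (determined by `m(σᵢ) = σᵢ⁻¹`) and every
integer `n`: `m(Δ^{-2n}σ₁σ₂)` is conjugate to `Δ^{2n-2}(σ₁σ₂)²`, and
`m(Δ^{-2n}(σ₁σ₂)²)` is conjugate to `Δ^{2n-2}σ₁σ₂`. -/
theorem mirror_conjugate (m : B₃ →* B₃)
    (hm1 : m σ₁ = σ₁⁻¹) (hm2 : m σ₂ = σ₂⁻¹) (n : ℤ) :
    IsConj (m (Δ ^ (-(2 * n)) * σ₁ * σ₂)) (Δ ^ (2 * n - 2) * (σ₁ * σ₂) ^ 2) ∧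
      IsConj (m (Δ ^ (-(2 * n)) * (σ₁ * σ₂) ^ 2)) (Δ ^ (2 * n - 2) * (σ₁ * σ₂)) := by
  have hr := braid_rel
  have h1 : Δ * σ₁ = σ₂ * Δ := by
    unfold Δ
    nth_rewrite 1 [hr]
    simp only [mul_assoc]
  have h2 : Δ * σ₂ = σ₁ * Δ := by
    unfold Δ
    nth_rewrite 2 [hr]
    simp only [mul_assoc]
  have hc : SemiconjBy Δ (σ₂ * σ₁) (σ₁ * σ₂) := SemiconjBy.mul_right h2 h1
  have h3 : Δ ^ (2 : ℤ) = (σ₁ * σ₂) ^ 3 := by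
    have : Δ ^ (2 : ℤ) = (σ₁ * σ₂ * σ₁) * (σ₁ * σ₂ * σ₁) := by
      rw [zpow_ofNat, pow_two]; rfl
    rw [this]
    nth_rewrite 2 [hr]
    simp only [pow_succ, pow_zero, one_mul, mul_assoc]
  have hmΔ : m Δ = Δ⁻¹ := by
    unfold Δ
    simp only [map_mul, hm1, hm2, mul_inv_rev, mul_assoc]
  have hmz : m (Δ ^ (-(2 * n))) = Δ ^ (2 * n) := by
    rw [map_zpow, hmΔ, inv_zpow, zpow_neg, inv_inv]
  have hmab : m (σ₁ * σ₂) = (σ₂ * σ₁)⁻¹ := by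
    rw [map_mul, hm1, hm2, mul_inv_rev]
  have hz : SemiconjBy Δ (Δ ^ (2 * n)) (Δ ^ (2 * n)) := (Commute.refl Δ).zpow_right _
  constructor
  · rw [isConj_iff]
    refine ⟨Δ, ?_⟩
    rw [mul_assoc (Δ ^ _), map_mul, hmz, hmab, mul_inv_eq_iff_eq_mul,
      (hz.mul_right hc.inv_right).eq, zpow_sub, h3]
    generalize σ₁ * σ₂ = x
    group
  · rw [isConj_iff]
    refine ⟨Δ, ?_⟩
    rw [map_mul, hmz, map_pow, hmab, mul_inv_eq_iff_eq_mul,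
      (hz.mul_right (hc.inv_right.pow_right 2)).eq, zpow_sub, h3]
    generalize σ₁ * σ₂ = x
    group
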